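/- Let (u₂, z₂) be a classical solution of the Stefan problem (see context), and set 𝒰₂(t,x) := ∫ₓ^∞ u₂(t,y) dy. Then the moving boundary z₂ satisfies, for all t > 0, the integral equation ∫₀^∞ p(t, z₂(t) − y) (𝒰₂(0,0) − 𝒰₂(0,y)) dy = ∫₀ᵗ p(t−s, z₂(t) − z₂(s)) ds. -/

import Mathlib

open MeasureTheory Real Set

/-- The heat kernel `p(t,x) = (2πt)^{-1/2} exp(-x²/(2t))`. -/
noncomputable def heatK (t x : ℝ) : ℝ :=
  (Real.sqrt (2 * Real.pi * t))⁻¹ * Real.exp (-x ^ 2 / (2 * t))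

/-- The Neumann heat kernel `p_N(t,y,x) = p(t,y-x) + p(t,y+x)`. -/
noncomputable def heatKN (t y x : ℝ) : ℝ := heatK t (y - x) + heatK t (y + x)

/-- The space-time domain `D = {(t,x) : t > 0, x ≥ z₂(t)}` of the Stefan problem. -/
def stefanDomain (z₂ : ℝ → ℝ) : Set (ℝ × ℝ) := {q : ℝ × ℝ | 0 < q.1 ∧ z₂ q.1 ≤ q.2}

/-- A classical solution `(u₂, z₂)` of the Stefan problem:
`z₂` is `C¹` on `(0,∞)`, continuous on `[0,∞)`, nondecreasing, with `z₂(0) = 0`;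
`u₂` is bounded and integrable on the closure of `D` (in particular integrable on each
slice `[z₂(t),∞)`), and extends to a `C²` function on a neighborhood of the closure of `D`;
`u₂` solves the heat equation `∂ₜu₂ = (1/2)∂ₓₓu₂` for `t > 0`, `x > z₂(t)`;
`u₂(t, z₂(t)) = 2` for all `t ≥ 0`; and the Stefan boundary condition
`2 z₂'(t) + (1/2)∂ₓu₂(t,z₂(t)) = 0` holds for all `t > 0`. -/
structure StefanSolution (z₂ : ℝ → ℝ) (u₂ : ℝ → ℝ → ℝ) : Prop where
  z_contDiff : ContDiffOn ℝ 1 z₂ (Set.Ioi 0)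
  z_cont : ContinuousOn z₂ (Set.Ici 0)
  z_mono : MonotoneOn z₂ (Set.Ici 0)
  z_init : z₂ 0 = 0
  u_bdd : ∃ M : ℝ, ∀ q ∈ closure (stefanDomain z₂), |u₂ q.1 q.2| ≤ M
  u_int : MeasureTheory.IntegrableOn (fun q : ℝ × ℝ => u₂ q.1 q.2) (closure (stefanDomain z₂))
  u_intSlice : ∀ t : ℝ, 0 ≤ t → MeasureTheory.IntegrableOn (u₂ t) (Set.Ici (z₂ t))
  u_smooth : ∃ V : Set (ℝ × ℝ), IsOpen V ∧ closure (stefanDomain z₂) ⊆ V ∧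
      ContDiffOn ℝ 2 (fun q : ℝ × ℝ => u₂ q.1 q.2) V
  heatEq : ∀ t > (0:ℝ), ∀ x : ℝ, z₂ t < x →
      deriv (fun τ : ℝ => u₂ τ x) t = (1 / 2) * deriv (deriv (u₂ t)) x
  bdryVal : ∀ t ≥ (0:ℝ), u₂ t (z₂ t) = 2
  stefanBC : ∀ t > (0:ℝ), 2 * deriv z₂ t + (1 / 2) * deriv (u₂ t) (z₂ t) = 0

/-- The tail distribution function `𝒰₂(t,x) = ∫ₓ^∞ u₂(t,y) dy`. -/
noncomputable def tailDist (u₂ : ℝ → ℝ → ℝ) (t x : ℝ) : ℝ := ∫ y in Set.Ioi x, u₂ t y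

open Filter Topology

/-- A parametric integral over a compact rectangle is continuous in the parameter. -/
theorem continuousOn_parametric_integral {f : ℝ → ℝ → ℝ} {a b c d : ℝ} (hab : a ≤ b) (hcd : c ≤ d)
    (hf : ContinuousOn (fun q : ℝ × ℝ => f q.1 q.2) (Icc a b ×ˢ Icc c d)) :
    ContinuousOn (fun s => ∫ r in c..d, f s r) (Icc a b) := by
  have hF : Continuous (Function.uncurry
      (fun s r => f (projIcc a b hab s : ℝ) (projIcc c d hcd r : ℝ))) := by
    have hg : Continuous (fun q : ℝ × ℝ =>
        ((projIcc a b hab q.1 : ℝ), (projIcc c d hcd q.2 : ℝ))) := by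
      have h1 := continuous_projIcc (h := hab)
      have h2 := continuous_projIcc (h := hcd)
      fun_prop
    exact hf.comp_continuous hg fun q => ⟨Subtype.coe_prop _, Subtype.coe_prop _⟩
  refine (intervalIntegral.continuous_parametric_intervalIntegral_of_continuous' (μ := volume)
    hF c d).continuousOn.congr fun s hs => ?_
  refine intervalIntegral.integral_congr fun r hr => ?_
  rw [uIcc_of_le hcd] at hr
  simp only [projIcc_of_mem hab hs, projIcc_of_mem hcd hr]

/-- Differentiation under the integral sign over a compact interval. -/
theorem hasDerivAt_parametric_integral {f f' : ℝ → ℝ → ℝ} {a b c d s : ℝ} (hcd : c ≤ d)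
    (hs : s ∈ Ioo a b)
    (hf : ContinuousOn (fun q : ℝ × ℝ => f q.1 q.2) (Ioo a b ×ˢ Icc c d))
    (hf' : ContinuousOn (fun q : ℝ × ℝ => f' q.1 q.2) (Ioo a b ×ˢ Icc c d))
    (hd : ∀ σ ∈ Ioo a b, ∀ r ∈ Icc c d, HasDerivAt (fun σ => f σ r) (f' σ r) σ) :
    HasDerivAt (fun σ => ∫ r in c..d, f σ r) (∫ r in c..d, f' s r) s := by
  obtain ⟨a', haa', ha's⟩ := exists_between hs.1
  obtain ⟨b', hsb', hb'b⟩ := exists_between hs.2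
  have hsub : Icc a' b' ⊆ Ioo a b := fun x hx => ⟨haa'.trans_le hx.1, hx.2.trans_lt hb'b⟩
  obtain ⟨C, hC⟩ := (isCompact_Icc.prod isCompact_Icc).exists_bound_of_continuousOn
    (hf'.mono (prod_mono_left hsub : Icc a' b' ×ˢ Icc c d ⊆ _))
  have hslice : ∀ {g : ℝ → ℝ → ℝ},
      ContinuousOn (fun q : ℝ × ℝ => g q.1 q.2) (Ioo a b ×ˢ Icc c d) →
      ∀ σ ∈ Ioo a b, IntervalIntegrable (g σ) volume c d := by
    intro g hg σ hσ
    refine ContinuousOn.intervalIntegrable ?_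
    rw [uIcc_of_le hcd]
    exact hg.comp (f := fun r => (σ, r)) (by fun_prop) fun r hr => ⟨hσ, hr⟩
  refine (intervalIntegral.hasDerivAt_integral_of_dominated_loc_of_deriv_le
    (bound := fun _ => C) (Icc_mem_nhds ha's hsb') ?_ (hslice hf s hs)
    (hslice hf' s hs).def'.aestronglyMeasurable ?_ (by simp) ?_).2
  · filter_upwards [Ioo_mem_nhds hs.1 hs.2] with σ hσ
    exact (hslice hf σ hσ).def'.aestronglyMeasurable
  · refine ae_of_all _ fun r hr σ hσ => ?_
    rw [uIoc_of_le hcd] at hr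
    exact hC (σ, r) ⟨hσ, Ioc_subset_Icc_self hr⟩
  · refine ae_of_all _ fun r hr σ hσ => ?_
    rw [uIoc_of_le hcd] at hr
    exact hd σ (hsub hσ) r (Ioc_subset_Icc_self hr)

/-- The upper tail of the standard normal distribution. -/
noncomputable def gaussTail (x : ℝ) : ℝ := ∫ w in Ioi x, heatK 1 w

theorem heatK_one (x : ℝ) : heatK 1 x = (√(2 * π))⁻¹ * rexp (-(1 / 2) * x ^ 2) := by
  simp only [heatK, mul_one]
  ring_nf

theorem heatK_nonneg (t x : ℝ) : 0 ≤ heatK t x := by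
  unfold heatK; positivity

theorem heatK_neg (t x : ℝ) : heatK t (-x) = heatK t x := by
  simp [heatK]

theorem heatK_eq_scaled {σ : ℝ} (hσ : 0 < σ) (x : ℝ) :
    heatK σ x = heatK 1 (x / √σ) / √σ := by
  rw [heatK_one, heatK, Real.sqrt_mul (by positivity), div_pow, Real.sq_sqrt hσ.le]
  rw [show -x ^ 2 / (2 * σ) = -(1 / 2) * (x ^ 2 / σ) by field_simp]
  field_simp

theorem contDiff_heatK_one : ContDiff ℝ 2 (heatK 1) := by
  rw [show heatK 1 = fun x => (√(2 * π))⁻¹ * rexp (-(1 / 2) * x ^ 2) from funext heatK_one]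
  fun_prop

theorem continuous_heatK_one : Continuous (heatK 1) := contDiff_heatK_one.continuous

theorem hasDerivAt_heatK_one (x : ℝ) : HasDerivAt (heatK 1) (-x * heatK 1 x) x := by
  rw [show heatK 1 = fun x => (√(2 * π))⁻¹ * rexp (-(1 / 2) * x ^ 2) from funext heatK_one]
  refine ((((hasDerivAt_pow 2 x).const_mul (-(1 / 2) : ℝ)).exp).const_mul
    (√(2 * π))⁻¹).congr_deriv ?_
  norm_num
  ring

theorem integrable_heatK_one : Integrable (heatK 1) := by
  rw [show heatK 1 = fun x => (√(2 * π))⁻¹ * rexp (-(1 / 2) * x ^ 2) from funext heatK_one]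
  exact (integrable_exp_neg_mul_sq (by norm_num)).const_mul _

theorem integral_heatK_one : ∫ x, heatK 1 x = 1 := by
  simp_rw [heatK_one]
  rw [integral_const_mul, integral_gaussian, show π / (1 / 2) = 2 * π by ring]
  exact inv_mul_cancel₀ (by positivity)

theorem heatK_one_le_exp_neg (x : ℝ) : heatK 1 x ≤ rexp (-x) := by
  have h1 : rexp (1 / 2) ≤ √(2 * π) := by
    refine Real.le_sqrt_of_sq_le ?_
    rw [← Real.exp_nat_mul]
    norm_num
    linarith [Real.exp_one_lt_d9, Real.pi_gt_three]
  rw [heatK_one, inv_mul_le_iff₀ (by positivity)]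
  calc rexp (-(1 / 2) * x ^ 2) ≤ rexp (1 / 2 + -x) :=
        Real.exp_le_exp.2 (by nlinarith [sq_nonneg (x - 1)])
    _ = rexp (1 / 2) * rexp (-x) := Real.exp_add _ _
    _ ≤ _ := by gcongr

theorem heatK_one_le_one (x : ℝ) : heatK 1 x ≤ 1 := by
  have h := heatK_one_le_exp_neg |x|
  have h2 : heatK 1 |x| = heatK 1 x := by simp [heatK]
  rw [h2] at h
  exact h.trans (Real.exp_le_one_iff.2 (by simp))

theorem gaussTail_nonneg (x : ℝ) : 0 ≤ gaussTail x :=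
  integral_nonneg fun _ => heatK_nonneg _ _

theorem gaussTail_le_one (x : ℝ) : gaussTail x ≤ 1 := by
  rw [← integral_heatK_one]
  exact setIntegral_le_integral integrable_heatK_one (ae_of_all _ fun _ => heatK_nonneg _ _)

theorem gaussTail_le_exp_neg (x : ℝ) : gaussTail x ≤ rexp (-x) := by
  rw [← integral_exp_neg_Ioi]
  exact setIntegral_mono integrable_heatK_one.integrableOn
    (integrableOn_exp_neg_Ioi x) heatK_one_le_exp_neg

theorem hasDerivAt_gaussTail (x : ℝ) : HasDerivAt gaussTail (-heatK 1 x) x := by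
  have h : gaussTail = fun x => gaussTail 0 - ∫ w in (0 : ℝ)..x, heatK 1 w := by
    funext x
    rw [← intervalIntegral.integral_Ioi_sub_Ioi' integrable_heatK_one.integrableOn
      integrable_heatK_one.integrableOn]
    simp [gaussTail]
  rw [h]
  exact (intervalIntegral.integral_hasDerivAt_right integrable_heatK_one.intervalIntegrable
    (continuous_heatK_one.stronglyMeasurableAtFilter _ _)
    continuous_heatK_one.continuousAt).const_sub _

theorem continuous_gaussTail : Continuous gaussTail :=
  continuous_iff_continuousAt.2 fun x => (hasDerivAt_gaussTail x).continuousAt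

/-- A smooth cutoff with bounded first and second derivatives. -/
theorem smoothTransition_derivs :
    ∃ S' S'' : ℝ → ℝ, (∀ x, HasDerivAt smoothTransition (S' x) x) ∧
      (∀ x, HasDerivAt S' (S'' x) x) ∧ Continuous S' ∧ Continuous S'' ∧
      (∀ x ≤ 0, S' x = 0) ∧ (∀ x, 1 < x → S' x = 0 ∧ S'' x = 0) ∧
      ∃ C, 0 ≤ C ∧ ∀ x, |S' x| ≤ C ∧ |S'' x| ≤ C := by
  have hS : ContDiff ℝ 2 smoothTransition := smoothTransition.contDiff (n := 2)
  have hS' : ContDiff ℝ 1 (deriv smoothTransition) :=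
    ((contDiff_succ_iff_deriv (n := 1)).1 hS).2.2
  have hS'' : Continuous (deriv (deriv smoothTransition)) := hS'.continuous_deriv le_rfl
  have hneg : ∀ x < 0, deriv smoothTransition x = 0 ∧ deriv (deriv smoothTransition) x = 0 := by
    intro x hx
    have h0 : smoothTransition =ᶠ[𝓝 x] fun _ => 0 := by
      filter_upwards [Iio_mem_nhds hx] with y hy
      exact smoothTransition.zero_of_nonpos (le_of_lt hy)
    have h1 : deriv smoothTransition =ᶠ[𝓝 x] fun _ => 0 := by simpa using h0.deriv
    exact ⟨h1.self_of_nhds, by simpa using h1.deriv.self_of_nhds⟩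
  have hpos : ∀ x, 1 < x →
      deriv smoothTransition x = 0 ∧ deriv (deriv smoothTransition) x = 0 := by
    intro x hx
    have h0 : smoothTransition =ᶠ[𝓝 x] fun _ => 1 := by
      filter_upwards [Ioi_mem_nhds hx] with y hy
      exact smoothTransition.one_of_one_le (le_of_lt hy)
    have h1 : deriv smoothTransition =ᶠ[𝓝 x] fun _ => 0 := by simpa using h0.deriv
    exact ⟨h1.self_of_nhds, by simpa using h1.deriv.self_of_nhds⟩
  obtain ⟨C₁, hC₁⟩ := (isCompact_Icc (a := (0 : ℝ)) (b := 1)).exists_bound_of_continuousOn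
    hS'.continuous.continuousOn
  obtain ⟨C₂, hC₂⟩ := (isCompact_Icc (a := (0 : ℝ)) (b := 1)).exists_bound_of_continuousOn
    hS''.continuousOn
  refine ⟨_, _, fun x => (hS.differentiable (by norm_num) x).hasDerivAt,
    fun x => (hS'.differentiable (by norm_num) x).hasDerivAt, hS'.continuous, hS'', ?_, hpos,
    max 0 (max C₁ C₂), le_max_left _ _, fun x => ?_⟩
  · intro x hx
    refine IsLocalMin.deriv_eq_zero (Eventually.of_forall fun y => ?_)
    rw [smoothTransition.zero_of_nonpos hx]
    exact smoothTransition.nonneg y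
  · rcases lt_or_ge x 0 with hx | hx
    · simp [hneg x hx]
    rcases lt_or_ge 1 x with hx1 | hx1
    · simp [hpos x hx1]
    · exact ⟨(hC₁ x ⟨hx, hx1⟩).trans (by simp), (hC₂ x ⟨hx, hx1⟩).trans (by simp)⟩

namespace StefanSolution

variable {z : ℝ → ℝ} {u : ℝ → ℝ → ℝ}

theorem nonneg (h : StefanSolution z u) {s : ℝ} (hs : 0 ≤ s) : 0 ≤ z s := by
  simpa [h.z_init] using h.z_mono (mem_Ici.2 le_rfl) (mem_Ici.2 hs) hs

theorem mem_closure (h : StefanSolution z u) {s x : ℝ} (hs : 0 ≤ s) (hx : z s ≤ x) :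
    (s, x) ∈ closure (stefanDomain z) := by
  have hz : Tendsto z (𝓝[>] s) (𝓝 (z s)) :=
    (h.z_cont s hs).mono_left (nhdsWithin_mono s fun y hy => hs.trans (le_of_lt hy))
  have ht : Tendsto (fun σ => (σ, x + (z σ - z s))) (𝓝[>] s) (𝓝 (s, x)) := by
    have h2 : Tendsto (fun σ => x + (z σ - z s)) (𝓝[>] s) (𝓝 x) := by
      simpa using (hz.sub_const (z s)).const_add x
    exact (tendsto_nhdsWithin_of_tendsto_nhds tendsto_id).prodMk_nhds h2
  refine mem_closure_of_tendsto ht ?_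
  filter_upwards [self_mem_nhdsWithin] with σ hσ
  exact ⟨hs.trans_lt hσ, by simp only; linarith⟩

/-- First partial derivatives of the temperature, together with their continuity up to the
boundary and initial time, and the boundary condition and heat equation in terms of them. -/
theorem exists_partials (h : StefanSolution z u) : ∃ us uy : ℝ → ℝ → ℝ,
    ContinuousOn (fun q : ℝ × ℝ => u q.1 q.2) (closure (stefanDomain z)) ∧
    ContinuousOn (fun q : ℝ × ℝ => us q.1 q.2) (closure (stefanDomain z)) ∧
    ContinuousOn (fun q : ℝ × ℝ => uy q.1 q.2) (closure (stefanDomain z)) ∧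
    (∀ s x, (s, x) ∈ closure (stefanDomain z) → ∀ (y : ℝ → ℝ) (y' : ℝ), HasDerivAt y y' s →
      y s = x → HasDerivAt (fun σ => u σ (y σ)) (us s x + y' * uy s x) s) ∧
    (∀ s x, (s, x) ∈ closure (stefanDomain z) → HasDerivAt (u s) (uy s x) x) ∧
    (∀ s > 0, ∀ x, z s < x → HasDerivAt (uy s) (2 * us s x) x) ∧
    (∀ s > 0, uy s (z s) = -4 * deriv z s) := by
  obtain ⟨V, hV, hVs, hc⟩ := h.u_smooth
  set U : ℝ × ℝ → ℝ := fun q => u q.1 q.2 with hU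
  have hF : ∀ q ∈ V, HasFDerivAt U (fderiv ℝ U q) q := fun q hq =>
    ((hc.contDiffAt (hV.mem_nhds hq)).differentiableAt (by norm_num)).hasFDerivAt
  have hF' : ContDiffOn ℝ 1 (fderiv ℝ U) V := hc.fderiv_of_isOpen hV (by norm_num)
  have hs : ∀ s x, (s, x) ∈ V → ∀ (y : ℝ → ℝ) (y' : ℝ), HasDerivAt y y' s → y s = x →
      HasDerivAt (fun σ => u σ (y σ))
        (fderiv ℝ U (s, x) (1, 0) + y' * fderiv ℝ U (s, x) (0, 1)) s := by
    intro s x hq y y' hy hyx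
    subst hyx
    have := (hF _ hq).comp_hasDerivAt s ((hasDerivAt_id s).prodMk hy)
    refine this.congr_deriv ?_
    rw [show ((1 : ℝ), y') = (1, 0) + y' • ((0 : ℝ), (1 : ℝ)) by simp, map_add, map_smul,
      smul_eq_mul]
  have hx : ∀ s x, (s, x) ∈ V → HasDerivAt (u s) (fderiv ℝ U (s, x) (0, 1)) x := by
    intro s x hq
    exact (hF _ hq).comp_hasDerivAt x ((hasDerivAt_const x s).prodMk (hasDerivAt_id x))
  refine ⟨fun s x => fderiv ℝ U (s, x) (1, 0), fun s x => fderiv ℝ U (s, x) (0, 1),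
    hc.continuousOn.mono hVs, ?_, ?_, fun s x hq => hs s x (hVs hq),
    fun s x hq => hx s x (hVs hq), ?_, ?_⟩
  · exact (hF'.continuousOn.mono hVs).clm_apply continuousOn_const
  · exact (hF'.continuousOn.mono hVs).clm_apply continuousOn_const
  · intro s hs0 x hzx
    have hq : (s, x) ∈ V := hVs (h.mem_closure hs0.le hzx.le)
    have hev : deriv (u s) =ᶠ[𝓝 x] fun x => fderiv ℝ U (s, x) (0, 1) := by
      have : ∀ᶠ x' in 𝓝 x, (s, x') ∈ V :=
        (Continuous.prodMk_right s).continuousAt.eventually (hV.mem_nhds hq)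
      filter_upwards [this] with x' hx'
      exact (hx s x' hx').deriv
    have hd : DifferentiableAt ℝ (fun x => fderiv ℝ U (s, x) (0, 1)) x := by
      have h1 : DifferentiableAt ℝ (fderiv ℝ U) (s, x) :=
        (hF'.contDiffAt (hV.mem_nhds hq)).differentiableAt (by norm_num)
      have h2 : DifferentiableAt ℝ (fun x => fderiv ℝ U (s, x)) x :=
        h1.comp (f := fun x : ℝ => (s, x)) x (by fun_prop)
      exact h2.clm_apply (by fun_prop)
    have he := h.heatEq s hs0 x hzx
    rw [hev.deriv_eq] at he
    have ht : deriv (fun τ => u τ x) s = fderiv ℝ U (s, x) (1, 0) := by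
      simpa using (hs s x hq (fun _ => x) 0 (hasDerivAt_const s x) rfl).deriv
    rw [ht] at he
    refine hd.hasDerivAt.congr_deriv ?_
    linarith
  · intro s hs0
    have := h.stefanBC s hs0
    rw [(hx s (z s) (hVs (h.mem_closure hs0.le le_rfl))).deriv] at this
    simp only
    linarith

/-- Green's identity for a classical Stefan solution tested against a function `ψ` that vanishes
to first order beyond `B`. -/
theorem green_identity (h : StefanSolution z u) {τ B : ℝ} (hτ : 0 ≤ τ) (hB : 0 ≤ B)
    {ψ ψs ψy ψyy : ℝ → ℝ → ℝ}
    (hcurve : ∀ s ∈ Ioo 0 τ, ∀ (y : ℝ → ℝ) (y' : ℝ), HasDerivAt y y' s →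
      HasDerivAt (fun σ => ψ σ (y σ)) (ψs s (y s) + y' * ψy s (y s)) s)
    (hψy : ∀ s ∈ Ioo 0 τ, ∀ x, HasDerivAt (ψ s) (ψy s x) x)
    (hψyy : ∀ s ∈ Ioo 0 τ, ∀ x, HasDerivAt (ψy s) (ψyy s x) x)
    (cψ : ContinuousOn (fun q : ℝ × ℝ => ψ q.1 q.2) (Icc 0 τ ×ˢ univ))
    (cψs : ContinuousOn (fun q : ℝ × ℝ => ψs q.1 q.2) (Icc 0 τ ×ˢ univ))
    (cψy : ContinuousOn (fun q : ℝ × ℝ => ψy q.1 q.2) (Icc 0 τ ×ˢ univ))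
    (cψyy : ContinuousOn (fun q : ℝ × ℝ => ψyy q.1 q.2) (Icc 0 τ ×ˢ univ))
    (hfar : ∀ s ∈ Ioo 0 τ, ∀ x, B ≤ x → ψ s x = 0 ∧ ψy s x = 0) :
    (∫ r in (0 : ℝ)..B, u τ (z τ + r) * ψ τ (z τ + r)) -
        ∫ r in (0 : ℝ)..B, u 0 (z 0 + r) * ψ 0 (z 0 + r) =
      (∫ s in (0 : ℝ)..τ, ψy s (z s)) + ∫ s in (0 : ℝ)..τ,
        ∫ r in (0 : ℝ)..B, u s (z s + r) * (ψs s (z s + r) + 1 / 2 * ψyy s (z s + r)) := by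
  obtain ⟨us, uy, cu, cus, cuy, husc, huy, huyy, hbc⟩ := h.exists_partials
  have cz : ContinuousOn (fun q : ℝ × ℝ => z q.1) (Icc 0 τ ×ˢ Icc 0 B) :=
    h.z_cont.comp continuousOn_fst fun q hq => hq.1.1
  have cpath : ContinuousOn (fun q : ℝ × ℝ => (q.1, z q.1 + q.2)) (Icc 0 τ ×ˢ Icc 0 B) :=
    continuousOn_fst.prodMk (cz.add continuousOn_snd)
  have shift : ∀ {g : ℝ → ℝ → ℝ},
      ContinuousOn (fun q : ℝ × ℝ => g q.1 q.2) (Icc 0 τ ×ˢ univ) →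
      ContinuousOn (fun q : ℝ × ℝ => g q.1 (z q.1 + q.2)) (Icc 0 τ ×ˢ Icc 0 B) :=
    fun hg => hg.comp cpath fun q hq => ⟨hq.1, mem_univ _⟩
  have shift' : ∀ {g : ℝ → ℝ → ℝ},
      ContinuousOn (fun q : ℝ × ℝ => g q.1 q.2) (closure (stefanDomain z)) →
      ContinuousOn (fun q : ℝ × ℝ => g q.1 (z q.1 + q.2)) (Icc 0 τ ×ˢ Icc 0 B) :=
    fun hg => hg.comp cpath fun q hq => h.mem_closure hq.1.1 (le_add_of_nonneg_right hq.2.1)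
  have dψ := shift cψ
  have dψs := shift cψs
  have dψy := shift cψy
  have dψyy := shift cψyy
  have du := shift' cu
  have dus := shift' cus
  have duy := shift' cuy
  have cf : ContinuousOn (fun q : ℝ × ℝ => u q.1 (z q.1 + q.2) * ψ q.1 (z q.1 + q.2))
      (Icc 0 τ ×ˢ Icc 0 B) := du.mul dψ
  have cE : ContinuousOn (fun q : ℝ × ℝ => u q.1 (z q.1 + q.2) *
      (ψs q.1 (z q.1 + q.2) + 1 / 2 * ψyy q.1 (z q.1 + q.2))) (Icc 0 τ ×ˢ Icc 0 B) :=
    du.mul (dψs.add (dψyy.const_mul _))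
  have cbd : ContinuousOn (fun s => ψy s (z s)) (Icc 0 τ) := by
    refine cψy.comp (f := fun s => (s, z s)) ?_ fun s hs => ⟨hs, mem_univ _⟩
    exact continuousOn_id.prodMk (h.z_cont.mono fun s hs => hs.1)
  rw [← intervalIntegral.integral_add (cbd.intervalIntegrable_of_Icc hτ)
    ((continuousOn_parametric_integral hτ hB cE).intervalIntegrable_of_Icc hτ)]
  symm
  refine intervalIntegral.integral_eq_sub_of_hasDerivAt_of_le hτ
    (f := fun s => ∫ r in (0 : ℝ)..B, u s (z s + r) * ψ s (z s + r))
    (continuousOn_parametric_integral hτ hB cf) (fun s hs => ?_) ?_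
  swap
  · exact (cbd.add (continuousOn_parametric_integral hτ hB cE)).intervalIntegrable_of_Icc hτ
  have hsub : Ioo 0 τ ×ˢ Icc 0 B ⊆ Icc 0 τ ×ˢ Icc 0 B := prod_mono_left Ioo_subset_Icc_self
  have hz' : ∀ σ ∈ Ioo 0 τ, HasDerivAt z (deriv z σ) σ := fun σ hσ =>
    ((h.z_contDiff.contDiffAt (Ioi_mem_nhds hσ.1)).differentiableAt (by norm_num)).hasDerivAt
  have cz' : ContinuousOn (fun q : ℝ × ℝ => deriv z q.1) (Ioo 0 τ ×ˢ Icc 0 B) :=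
    (h.z_contDiff.continuousOn_deriv_of_isOpen isOpen_Ioi le_rfl).comp continuousOn_fst
      fun q hq => hq.1.1
  have key := hasDerivAt_parametric_integral hB hs (cf.mono hsub)
    (f' := fun σ r => (us σ (z σ + r) + deriv z σ * uy σ (z σ + r)) * ψ σ (z σ + r) +
      u σ (z σ + r) * (ψs σ (z σ + r) + deriv z σ * ψy σ (z σ + r)))
    ((((dus.mono hsub).add (cz'.mul (duy.mono hsub))).mul (dψ.mono hsub)).add
      ((du.mono hsub).mul ((dψs.mono hsub).add (cz'.mul (dψy.mono hsub)))))
    (fun σ hσ r hr => by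
      have hc := (hz' σ hσ).add_const r
      exact (husc σ (z σ + r) (h.mem_closure hσ.1.le (le_add_of_nonneg_right hr.1))
        (fun σ => z σ + r) _ hc rfl).mul (hcurve σ hσ (fun σ => z σ + r) _ hc))
  refine key.congr_deriv ?_
  have slice : ∀ {g : ℝ × ℝ → ℝ}, ContinuousOn g (Icc 0 τ ×ˢ Icc 0 B) →
      ContinuousOn (fun r => g (s, r)) (Icc 0 B) := fun hg =>
    hg.comp (f := fun r => (s, r)) (by fun_prop) fun r hr => ⟨Ioo_subset_Icc_self hs, hr⟩
  set D : ℝ → ℝ := fun r =>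
    deriv z s * (uy s (z s + r) * ψ s (z s + r) + u s (z s + r) * ψy s (z s + r)) +
      us s (z s + r) * ψ s (z s + r) - 1 / 2 * (u s (z s + r) * ψyy s (z s + r)) with hD
  have cD : ContinuousOn D (Icc 0 B) :=
    (((slice (duy.mul dψ)).add (slice (du.mul dψy))).const_mul _ |>.add
      (slice (dus.mul dψ))).sub ((slice (du.mul dψyy)).const_mul _)
  have ftc : ∫ r in (0 : ℝ)..B, D r = ψy s (z s) := by
    rw [intervalIntegral.integral_eq_sub_of_hasDerivAt_of_le hB
      (f := fun r => deriv z s * (u s (z s + r) * ψ s (z s + r)) +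
        1 / 2 * (uy s (z s + r) * ψ s (z s + r)) - 1 / 2 * (u s (z s + r) * ψy s (z s + r)))
      ((((slice (du.mul dψ)).const_mul _).add ((slice (duy.mul dψ)).const_mul _)).sub
        ((slice (du.mul dψy)).const_mul _)) ?_ (cD.intervalIntegrable_of_Icc hB)]
    · obtain ⟨h1, h2⟩ := hfar s hs (z s + B) (le_add_of_nonneg_left (h.nonneg hs.1.le))
      simp only [h1, h2, add_zero, h.bdryVal s hs.1.le, hbc s hs.1]
      ring
    · intro r hr
      have hm : z s < z s + r := lt_add_of_pos_right _ hr.1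
      have e0 := (huy s (z s + r) (h.mem_closure hs.1.le hm.le)).comp_const_add (z s) r
      have e1 := (huyy s hs.1 (z s + r) hm).comp_const_add (z s) r
      have e2 := (hψy s hs (z s + r)).comp_const_add (z s) r
      have e3 := (hψyy s hs (z s + r)).comp_const_add (z s) r
      refine ((((e0.mul e2).const_mul (deriv z s)).add ((e1.mul e2).const_mul (1 / 2))).sub
        ((e0.mul e3).const_mul (1 / 2))).congr_deriv ?_
      simp only [hD]
      ring
  rw [← ftc, ← intervalIntegral.integral_add (cD.intervalIntegrable_of_Icc hB)
    ((slice cE).intervalIntegrable_of_Icc hB)]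
  refine intervalIntegral.integral_congr fun r _ => ?_
  simp only [hD]
  ring

end StefanSolution

/-- The solution of the backward heat equation with terminal value `𝟙_{y < a}` at time `t`. -/
noncomputable def backwardTail (t a s y : ℝ) : ℝ := gaussTail ((y - a) / √(t - s))

theorem backwardTail_nonneg (t a s y : ℝ) : 0 ≤ backwardTail t a s y := gaussTail_nonneg _

theorem backwardTail_le_one (t a s y : ℝ) : backwardTail t a s y ≤ 1 := gaussTail_le_one _

theorem hasDerivAt_backwardTail_curve {t a s : ℝ} (hs : s < t) {y : ℝ → ℝ} {y' : ℝ}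
    (hy : HasDerivAt y y' s) :
    HasDerivAt (fun σ => backwardTail t a σ (y σ))
      (-heatK 1 ((y s - a) / √(t - s)) * ((y s - a) / √(t - s)) / (2 * (t - s)) +
        y' * (-heatK 1 ((y s - a) / √(t - s)) / √(t - s))) s := by
  have hσ : 0 < t - s := sub_pos.2 hs
  have hr : 0 < √(t - s) := Real.sqrt_pos.2 hσ
  have h1 : HasDerivAt (fun σ => √(t - σ)) (-1 / (2 * √(t - s))) s :=
    ((hasDerivAt_id s).const_sub t).sqrt hσ.ne'
  have h2 := (hasDerivAt_gaussTail _).comp s ((hy.sub_const a).div h1 hr.ne')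
  refine h2.congr_deriv ?_
  have hsq : t - s = √(t - s) ^ 2 := (Real.sq_sqrt hσ.le).symm
  generalize hq : √(t - s) = q at *
  rw [hsq]
  simp only [Pi.div_apply, hq]
  field_simp
  ring

theorem hasDerivAt_backwardTail (t a s x : ℝ) :
    HasDerivAt (backwardTail t a s) (-heatK 1 ((x - a) / √(t - s)) / √(t - s)) x := by
  refine ((hasDerivAt_gaussTail _).comp x
    (((hasDerivAt_id x).sub_const a).div_const √(t - s))).congr_deriv ?_
  simp only [id]
  ring

theorem hasDerivAt_backwardTail_deriv {t s : ℝ} (hs : s < t) (a x : ℝ) :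
    HasDerivAt (fun x => -heatK 1 ((x - a) / √(t - s)) / √(t - s))
      (heatK 1 ((x - a) / √(t - s)) * ((x - a) / √(t - s)) / (t - s)) x := by
  have hσ : 0 < t - s := sub_pos.2 hs
  have hr : 0 < √(t - s) := Real.sqrt_pos.2 hσ
  refine ((((hasDerivAt_heatK_one _).comp x
    (((hasDerivAt_id x).sub_const a).div_const √(t - s))).neg).div_const √(t - s)).congr_deriv ?_
  have hsq : t - s = √(t - s) ^ 2 := (Real.sq_sqrt hσ.le).symm
  generalize √(t - s) = q at *
  rw [hsq]
  simp only [id]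
  field_simp

theorem intervalIntegral_backwardTail_le {t a τ z B : ℝ} (hτ : τ < t) (hza : z ≤ a)
    (hB : a ≤ z + B) :
    ∫ r in (0 : ℝ)..B, backwardTail t a τ (z + r) ≤ (a - z) + √(t - τ) := by
  have hq : 0 < √(t - τ) := Real.sqrt_pos.2 (sub_pos.2 hτ)
  have hc : Continuous fun r => backwardTail t a τ (z + r) := by
    unfold backwardTail
    exact continuous_gaussTail.comp (by fun_prop)
  rw [← intervalIntegral.integral_add_adjacent_intervals (b := a - z)
    (hc.intervalIntegrable _ _) (hc.intervalIntegrable _ _)]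
  refine add_le_add ?_ ?_
  · refine (intervalIntegral.integral_mono_on (sub_nonneg.2 hza) (hc.intervalIntegrable _ _)
      (continuous_const (y := (1 : ℝ)).intervalIntegrable _ _)
      fun r _ => backwardTail_le_one _ _ _ _).trans ?_
    simp
  · have hd : ∀ r, HasDerivAt (fun r => -(√(t - τ) * rexp (-((z + r - a) / √(t - τ)))))
        (rexp (-((z + r - a) / √(t - τ)))) r := by
      intro r
      refine (((((hasDerivAt_id r).const_add z).sub_const a).div_const
        √(t - τ)).neg.exp.const_mul √(t - τ)).neg.congr_deriv ?_
      simp only [id, Pi.neg_apply]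
      field_simp
    have he : Continuous fun r => rexp (-((z + r - a) / √(t - τ))) := by fun_prop
    refine (intervalIntegral.integral_mono_on (by linarith) (hc.intervalIntegrable _ _)
      (he.intervalIntegrable _ _) fun r _ => gaussTail_le_exp_neg _).trans ?_
    rw [intervalIntegral.integral_eq_sub_of_hasDerivAt (fun r _ => hd r)
      (he.intervalIntegrable _ _)]
    simp only [add_sub_cancel, sub_self, zero_div, neg_zero, Real.exp_zero, mul_one]
    have : 0 ≤ √(t - τ) * rexp (-((z + B - a) / √(t - τ))) := by positivity
    linarith

namespace StefanSolution

variable {z : ℝ → ℝ} {u : ℝ → ℝ → ℝ}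

/-- Green's identity with a truncated backward heat kernel, with explicit error terms. -/
theorem abs_truncated_sub_le (h : StefanSolution z u) {M : ℝ}
    (hM : ∀ s ≥ 0, ∀ x ≥ z s, |u s x| ≤ M) (t : ℝ) :
    ∃ C, 0 ≤ C ∧ ∀ τ, 0 < τ → τ < t → ∀ N, z t < N →
      |(∫ r in (0 : ℝ)..(N + 1),
          u 0 r * (backwardTail t (z t) 0 r * smoothTransition (N + 1 - r))) -
        ∫ s in (0 : ℝ)..τ, heatK (t - s) (z t - z s)| ≤
      M * ((z t - z τ) + √(t - τ)) +
        M * (C * ((1 / √(t - τ) + 1) * rexp (-((N - z t) / √t)))) * (N + 1) * τ := by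
  obtain ⟨S', S'', hS, hS', cS', cS'', hS0, hS1, C, hC0, hC⟩ := smoothTransition_derivs
  refine ⟨C, hC0, fun τ hτ hτt N hzN => ?_⟩
  set a := z t
  have hN : 0 ≤ N := (h.nonneg (hτ.trans hτt).le).trans hzN.le
  have hM0 : 0 ≤ M := (abs_nonneg _).trans (hM 0 le_rfl (z 0) le_rfl)
  set Φy : ℝ → ℝ → ℝ := fun s x => -heatK 1 ((x - a) / √(t - s)) / √(t - s) with hΦy
  set ξ : ℝ × ℝ → ℝ := fun q => (q.2 - a) / √(t - q.1) with hξ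
  have csq : Continuous fun q : ℝ × ℝ => √(t - q.1) := by fun_prop
  have hsq0 : ∀ q ∈ Icc 0 τ ×ˢ (univ : Set ℝ), √(t - q.1) ≠ 0 := fun q hq =>
    (Real.sqrt_pos.2 (sub_pos.2 (hq.1.2.trans_lt hτt))).ne'
  have hsub0 : ∀ q ∈ Icc 0 τ ×ˢ (univ : Set ℝ), t - q.1 ≠ 0 := fun q hq =>
    (sub_pos.2 (hq.1.2.trans_lt hτt)).ne'
  have cξ : ContinuousOn ξ (Icc 0 τ ×ˢ univ) :=
    (continuous_snd.sub continuous_const).continuousOn.div csq.continuousOn hsq0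
  have cg : ContinuousOn (fun q => heatK 1 (ξ q)) (Icc 0 τ ×ˢ univ) :=
    continuous_heatK_one.comp_continuousOn cξ
  have cΦ : ContinuousOn (fun q : ℝ × ℝ => backwardTail t a q.1 q.2) (Icc 0 τ ×ˢ univ) :=
    continuous_gaussTail.comp_continuousOn cξ
  have cΦy : ContinuousOn (fun q : ℝ × ℝ => Φy q.1 q.2) (Icc 0 τ ×ˢ univ) :=
    cg.neg.div csq.continuousOn hsq0
  have cΦs : ContinuousOn (fun q => -heatK 1 (ξ q) * ξ q / (2 * (t - q.1)))
      (Icc 0 τ ×ˢ univ) :=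
    (cg.neg.mul cξ).div (by fun_prop) fun q hq => mul_ne_zero two_ne_zero (hsub0 q hq)
  have cΦyy : ContinuousOn (fun q => heatK 1 (ξ q) * ξ q / (t - q.1)) (Icc 0 τ ×ˢ univ) :=
    (cg.mul cξ).div (by fun_prop) hsub0
  have cut : ∀ {g : ℝ → ℝ}, Continuous g →
      ContinuousOn (fun q : ℝ × ℝ => g (N + 1 - q.2)) (Icc 0 τ ×ˢ univ) := fun hg =>
    (hg.comp (by fun_prop)).continuousOn
  have cSS := cut smoothTransition.continuous
  have cS'S := cut cS'
  have cS''S := cut cS''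
  have hcut : ∀ {g g' : ℝ → ℝ}, (∀ x, HasDerivAt g (g' x) x) → ∀ (y : ℝ → ℝ) (y' s : ℝ),
      HasDerivAt y y' s →
      HasDerivAt (fun σ => g (N + 1 - y σ)) (-(y' * g' (N + 1 - y s))) s := by
    intro g g' hg y y' s hy
    refine ((hg _).comp s (hy.const_sub (N + 1))).congr_deriv ?_
    ring
  have green := h.green_identity hτ.le (by linarith : 0 ≤ N + 1)
    (ψ := fun s x => backwardTail t a s x * smoothTransition (N + 1 - x))
    (ψs := fun s x => -heatK 1 (ξ (s, x)) * ξ (s, x) / (2 * (t - s)) *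
      smoothTransition (N + 1 - x))
    (ψy := fun s x => Φy s x * smoothTransition (N + 1 - x) -
      backwardTail t a s x * S' (N + 1 - x))
    (ψyy := fun s x => heatK 1 (ξ (s, x)) * ξ (s, x) / (t - s) * smoothTransition (N + 1 - x) -
      2 * (Φy s x * S' (N + 1 - x)) + backwardTail t a s x * S'' (N + 1 - x))
    (fun s hs y y' hy => by
      refine ((hasDerivAt_backwardTail_curve (hs.2.trans hτt) hy).mul
        (hcut hS y y' s hy)).congr_deriv ?_
      simp only [hξ, hΦy]
      ring)
    (fun s hs x => by
      refine ((hasDerivAt_backwardTail t a s x).mul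
        (hcut hS id 1 x (hasDerivAt_id x))).congr_deriv ?_
      simp only [hΦy, id]
      ring)
    (fun s hs x => by
      refine (((hasDerivAt_backwardTail_deriv (hs.2.trans hτt) a x).mul
        (hcut hS id 1 x (hasDerivAt_id x))).sub ((hasDerivAt_backwardTail t a s x).mul
        (hcut hS' id 1 x (hasDerivAt_id x)))).congr_deriv ?_
      simp only [hΦy, hξ, id]
      ring)
    (cΦ.mul cSS) (cΦs.mul cSS) ((cΦy.mul cSS).sub (cΦ.mul cS'S))
    (((cΦyy.mul cSS).sub ((cΦy.mul cS'S).const_mul 2)).add (cΦ.mul cS''S))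
    (fun s hs x hx => by
      have hx' : N + 1 - x ≤ 0 := by linarith
      simp [smoothTransition.zero_of_nonpos hx', hS0 _ hx'])
  have hz : ∀ s ∈ Icc 0 τ, z s ≤ a := fun s hs =>
    h.z_mono (mem_Ici.2 hs.1) (mem_Ici.2 (hτ.trans hτt).le) (hs.2.trans hτt.le)
  have hz0 : ∀ s ∈ Icc 0 τ, 0 ≤ z s := fun s hs => h.nonneg hs.1
  have hbd : (∫ s in (0 : ℝ)..τ, (Φy s (z s) * smoothTransition (N + 1 - z s) -
      backwardTail t a s (z s) * S' (N + 1 - z s))) =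
      -∫ s in (0 : ℝ)..τ, heatK (t - s) (a - z s) := by
    rw [← intervalIntegral.integral_neg]
    refine intervalIntegral.integral_congr fun s hs => ?_
    rw [uIcc_of_le hτ.le] at hs
    have h1 : 1 < N + 1 - z s := by linarith [hz s hs]
    simp only [smoothTransition.one_of_one_le h1.le, (hS1 _ h1).1, mul_one, mul_zero, sub_zero,
      hΦy]
    rw [← heatK_neg (t - s), neg_sub, heatK_eq_scaled (sub_pos.2 (hs.2.trans_lt hτt)), neg_div]
  rw [hbd] at green
  have hfinal : |∫ r in (0 : ℝ)..(N + 1), u τ (z τ + r) *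
      (backwardTail t a τ (z τ + r) * smoothTransition (N + 1 - (z τ + r)))| ≤
      M * ((a - z τ) + √(t - τ)) := by
    have hzτ := hz τ ⟨hτ.le, le_rfl⟩
    have hzτ0 := hz0 τ ⟨hτ.le, le_rfl⟩
    have hci : Continuous fun r => M * backwardTail t a τ (z τ + r) := by
      unfold backwardTail
      exact continuous_const.mul (continuous_gaussTail.comp (by fun_prop))
    have hN1 : 0 ≤ N + 1 := by linarith
    have hle := intervalIntegral.norm_integral_le_of_norm_le (f := fun r => u τ (z τ + r) *
      (backwardTail t a τ (z τ + r) * smoothTransition (N + 1 - (z τ + r))))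
      (μ := volume) hN1 (ae_of_all _ fun r hr => ?_) (hci.intervalIntegrable 0 (N + 1))
    · rw [intervalIntegral.integral_const_mul] at hle
      refine hle.trans (mul_le_mul_of_nonneg_left ?_ hM0)
      exact intervalIntegral_backwardTail_le hτt hzτ (by linarith)
    · have hΦ0 := backwardTail_nonneg t a τ (z τ + r)
      have hSn := smoothTransition.nonneg (N + 1 - (z τ + r))
      rw [Real.norm_eq_abs, abs_mul, abs_of_nonneg (mul_nonneg hΦ0 hSn)]
      refine mul_le_mul (hM τ hτ.le _ (le_add_of_nonneg_right hr.1.le))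
        (mul_le_of_le_one_right hΦ0 (smoothTransition.le_one _)) (mul_nonneg hΦ0 hSn) hM0
  set K : ℝ := (1 / √(t - τ) + 1) * rexp (-((N - a) / √t)) with hK
  have herr : ∀ s ∈ Icc 0 τ, ∀ x, 0 ≤ x →
      |-heatK 1 (ξ (s, x)) * ξ (s, x) / (2 * (t - s)) * smoothTransition (N + 1 - x) +
        1 / 2 * (heatK 1 (ξ (s, x)) * ξ (s, x) / (t - s) * smoothTransition (N + 1 - x) -
          2 * (Φy s x * S' (N + 1 - x)) + backwardTail t a s x * S'' (N + 1 - x))| ≤ C * K := by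
    intro s hs x hx
    have hst : 0 < t - s := sub_pos.2 (hs.2.trans_lt hτt)
    have hE : -heatK 1 (ξ (s, x)) * ξ (s, x) / (2 * (t - s)) * smoothTransition (N + 1 - x) +
        1 / 2 * (heatK 1 (ξ (s, x)) * ξ (s, x) / (t - s) * smoothTransition (N + 1 - x) -
          2 * (Φy s x * S' (N + 1 - x)) + backwardTail t a s x * S'' (N + 1 - x)) =
        -(Φy s x * S' (N + 1 - x)) + 1 / 2 * (backwardTail t a s x * S'' (N + 1 - x)) := by
      field_simp
      ring
    rw [hE]
    rcases lt_or_ge x N with hxN | hxN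
    · obtain ⟨h1, h2⟩ := hS1 (N + 1 - x) (by linarith)
      simp only [h1, h2, mul_zero, neg_zero, add_zero, abs_zero]
      positivity
    · have hq : √(t - τ) ≤ √(t - s) := Real.sqrt_le_sqrt (by linarith [hs.2])
      have hq0 : 0 < √(t - τ) := Real.sqrt_pos.2 (sub_pos.2 hτt)
      have hqt : √(t - s) ≤ √t := Real.sqrt_le_sqrt (by linarith [hs.1])
      have hexp : rexp (-((x - a) / √(t - s))) ≤ rexp (-((N - a) / √t)) := by
        refine Real.exp_le_exp.2 (neg_le_neg ?_)
        exact div_le_div₀ (by linarith) (by linarith) (hq0.trans_le hq) hqt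
      have b1 : |Φy s x| ≤ 1 / √(t - τ) * rexp (-((N - a) / √t)) := by
        rw [hΦy]
        simp only
        rw [abs_div, abs_neg, abs_of_nonneg (heatK_nonneg _ _), abs_of_nonneg (Real.sqrt_nonneg _),
          one_div_mul_eq_div]
        exact div_le_div₀ (Real.exp_pos _).le ((heatK_one_le_exp_neg _).trans hexp) hq0 hq
      have b2 : |backwardTail t a s x| ≤ rexp (-((N - a) / √t)) := by
        rw [abs_of_nonneg (backwardTail_nonneg _ _ _ _)]
        exact (gaussTail_le_exp_neg _).trans hexp
      obtain ⟨c1, c2⟩ := hC (N + 1 - x)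
      calc _ ≤ |Φy s x| * |S' (N + 1 - x)| + 1 / 2 * (|backwardTail t a s x| *
            |S'' (N + 1 - x)|) := by
              refine (abs_add_le _ _).trans_eq ?_
              rw [abs_neg, abs_mul, abs_mul, abs_mul, abs_of_pos (one_half_pos (α := ℝ))]
        _ ≤ 1 / √(t - τ) * rexp (-((N - a) / √t)) * C +
            1 / 2 * (rexp (-((N - a) / √t)) * C) := by gcongr
        _ ≤ C * K := by
          rw [hK]
          have : 0 ≤ rexp (-((N - a) / √t)) * C := by positivity
          linarith
  have hN1 : 0 ≤ N + 1 := by linarith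
  have hinner : ∀ s ∈ Icc 0 τ, ‖∫ r in (0 : ℝ)..(N + 1), u s (z s + r) *
      (-heatK 1 (ξ (s, z s + r)) * ξ (s, z s + r) / (2 * (t - s)) *
        smoothTransition (N + 1 - (z s + r)) + 1 / 2 * (heatK 1 (ξ (s, z s + r)) *
        ξ (s, z s + r) / (t - s) * smoothTransition (N + 1 - (z s + r)) -
        2 * (Φy s (z s + r) * S' (N + 1 - (z s + r))) +
        backwardTail t a s (z s + r) * S'' (N + 1 - (z s + r))))‖ ≤ M * (C * K) * (N + 1) := by
    intro s hs
    refine (intervalIntegral.norm_integral_le_of_norm_le_const fun r hr => ?_).trans_eq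
      (by rw [sub_zero, abs_of_nonneg hN1])
    rw [uIoc_of_le hN1] at hr
    rw [Real.norm_eq_abs, abs_mul]
    exact mul_le_mul (hM s hs.1 _ (le_add_of_nonneg_right hr.1.le))
      (herr s hs _ (add_nonneg (hz0 s hs) hr.1.le)) (abs_nonneg _) hM0
  have houter := intervalIntegral.norm_integral_le_of_norm_le_const (a := 0) (b := τ)
    fun s hs => hinner s (by rw [uIoc_of_le hτ.le] at hs; exact Ioc_subset_Icc_self hs)
  rw [sub_zero, abs_of_pos hτ, Real.norm_eq_abs] at houter
  simp only [h.z_init, zero_add] at green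
  rw [abs_le] at hfinal houter ⊢
  constructor <;> linarith [hfinal.1, hfinal.2, houter.1, houter.2]

end StefanSolution

theorem integrable_backwardTail_deriv {t s : ℝ} (hs : s < t) (a : ℝ) :
    Integrable fun x => -heatK 1 ((x - a) / √(t - s)) / √(t - s) := by
  have hq : √(t - s) ≠ 0 := (Real.sqrt_pos.2 (sub_pos.2 hs)).ne'
  exact (((integrable_heatK_one.comp_div hq).comp_sub_right a).neg).div_const _

theorem tendsto_linear_mul_exp_neg (a : ℝ) {q : ℝ} (hq : 0 < q) :
    Tendsto (fun n : ℕ => rexp (-((n - a) / q)) * ((n : ℝ) + 1)) atTop (𝓝 0) := by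
  have h1 : Tendsto (fun n : ℕ => ((n : ℝ) + 1) / q) atTop atTop :=
    (tendsto_atTop_add_const_right _ _ tendsto_natCast_atTop_atTop).atTop_div_const hq
  have h2 := ((Real.tendsto_pow_mul_exp_neg_atTop_nhds_zero 1).comp h1).const_mul
    (q * rexp ((a + 1) / q))
  rw [mul_zero] at h2
  refine h2.congr fun n => ?_
  have : rexp (-((n - a) / q)) = rexp ((a + 1) / q) * rexp (-((n + 1) / q)) := by
    rw [← Real.exp_add]
    congr 1
    field_simp
    ring
  simp only [Function.comp, pow_one, this]
  field_simp

namespace StefanSolution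

variable {z : ℝ → ℝ} {u : ℝ → ℝ → ℝ}

theorem continuousOn_initial (h : StefanSolution z u) : ContinuousOn (u 0) (Ici 0) := by
  obtain ⟨V, -, hVs, hc⟩ := h.u_smooth
  exact (hc.continuousOn.mono hVs).comp (f := fun x : ℝ => ((0 : ℝ), x)) (by fun_prop)
    fun x hx => h.mem_closure le_rfl (h.z_init.le.trans hx)

theorem integrableOn_initial (h : StefanSolution z u) : IntegrableOn (u 0) (Ioi 0) := by
  have := h.u_intSlice 0 le_rfl
  rw [h.z_init] at this
  exact this.mono_set Ioi_subset_Ici_self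

theorem tailDist_sub (h : StefanSolution z u) {y : ℝ} (hy : 0 ≤ y) :
    tailDist u 0 0 - tailDist u 0 y = ∫ x in (0 : ℝ)..y, u 0 x :=
  intervalIntegral.integral_Ioi_sub_Ioi h.integrableOn_initial hy

/-- Integration by parts on the left-hand side of the integral equation. -/
theorem integral_heatK_mul_tailDist (h : StefanSolution z u) {t : ℝ} (ht : 0 < t) (a : ℝ) :
    ∫ y in Ioi (0 : ℝ), heatK t (a - y) * (tailDist u 0 0 - tailDist u 0 y) =
      ∫ y in Ioi (0 : ℝ), u 0 y * backwardTail t a 0 y := by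
  have hu := h.integrableOn_initial
  set L := ∫ y in Ioi (0 : ℝ), ‖u 0 y‖
  set W : ℝ → ℝ := fun y => ∫ x in (0 : ℝ)..y, u 0 x with hW
  have hii : ∀ y, 0 ≤ y → IntervalIntegrable (u 0) volume 0 y := fun y hy =>
    (intervalIntegrable_iff_integrableOn_Ioc_of_le hy).2 (hu.mono_set Ioc_subset_Ioi_self)
  have hWL : ∀ y ∈ Ioi (0 : ℝ), ‖W y‖ ≤ L := by
    intro y hy
    rw [hW]
    simp only
    rw [intervalIntegral.integral_of_le (le_of_lt hy)]
    exact (norm_integral_le_integral_norm _).trans (setIntegral_mono_set hu.norm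
      (ae_of_all _ fun _ => norm_nonneg _) (ae_of_all _ Ioc_subset_Ioi_self))
  have hWd : ∀ y ∈ Ioi (0 : ℝ), HasDerivAt W (u 0 y) y := fun y hy =>
    intervalIntegral.integral_hasDerivAt_right (hii y (le_of_lt hy))
      ((h.continuousOn_initial.mono Ioi_subset_Ici_self).stronglyMeasurableAtFilter isOpen_Ioi y hy)
      (h.continuousOn_initial.continuousAt (Ici_mem_nhds hy))
  have hWc : ContinuousOn W (Ioi 0) := fun y hy => (hWd y hy).continuousAt.continuousWithinAt
  have hΦc : Continuous (backwardTail t a 0) :=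
    continuous_iff_continuousAt.2 fun y => (hasDerivAt_backwardTail t a 0 y).continuousAt
  have hW0 : Tendsto W (𝓝[>] 0) (𝓝 0) := by
    have hc := intervalIntegral.continuousOn_primitive_interval (μ := volume) (a := 0) (b := 1)
      (f := u 0) (by
        rw [uIcc_of_le zero_le_one, integrableOn_Icc_iff_integrableOn_Ioc]
        exact hu.mono_set Ioc_subset_Ioi_self)
    rw [uIcc_of_le zero_le_one] at hc
    have := (hc 0 ⟨le_rfl, zero_le_one⟩).tendsto
    rw [intervalIntegral.integral_same] at this
    refine this.mono_left ?_
    rw [← nhdsWithin_Ioo_eq_nhdsGT (zero_lt_one (α := ℝ))]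
    exact nhdsWithin_mono _ Ioo_subset_Icc_self
  have parts := integral_Ioi_mul_deriv_eq_deriv_mul (a := (0 : ℝ)) (u := W)
    (v := backwardTail t a 0) (a' := 0) (b' := 0) hWd
    (fun y _ => hasDerivAt_backwardTail t a 0 y)
    ((integrable_backwardTail_deriv ht a).integrableOn.bdd_mul
      (hWc.aestronglyMeasurable measurableSet_Ioi)
      ((ae_restrict_iff' measurableSet_Ioi).2 (ae_of_all _ hWL)))
    (hu.mul_bdd (c := 1) hΦc.aestronglyMeasurable (ae_of_all _ fun y => by
      rw [Real.norm_eq_abs, abs_of_nonneg (backwardTail_nonneg _ _ _ _)]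
      exact backwardTail_le_one _ _ _ _))
    (by
      have := hW0.mul (hΦc.tendsto 0 |>.mono_left nhdsWithin_le_nhds)
      rwa [zero_mul] at this)
    (by
      have hlim : Tendsto (fun y => L * rexp (-((y - a) / √(t - 0)))) atTop (𝓝 0) := by
        have h1 : Tendsto (fun y => (y - a) / √(t - 0)) atTop atTop :=
          (tendsto_atTop_add_const_right _ (-a) tendsto_id).atTop_div_const
            (Real.sqrt_pos.2 (by simpa using ht))
        simpa using (Real.tendsto_exp_neg_atTop_nhds_zero.comp h1).const_mul L
      refine squeeze_zero_norm' ?_ hlim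
      filter_upwards [Ioi_mem_atTop 0] with y hy
      rw [Pi.mul_apply, norm_mul]
      refine mul_le_mul (hWL y hy) ?_ (norm_nonneg _) ((norm_nonneg _).trans (hWL y hy))
      rw [Real.norm_eq_abs, abs_of_nonneg (backwardTail_nonneg _ _ _ _)]
      exact gaussTail_le_exp_neg _)
  rw [sub_self, zero_sub] at parts
  rw [← neg_inj, ← parts, ← integral_neg]
  refine setIntegral_congr_fun measurableSet_Ioi fun y hy => ?_
  simp only [h.tailDist_sub (le_of_lt hy), hW]
  rw [← heatK_neg t, neg_sub, heatK_eq_scaled ht, sub_zero]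
  ring

theorem tendsto_truncated (h : StefanSolution z u) (t a : ℝ) :
    Tendsto (fun n : ℕ => ∫ r in (0 : ℝ)..((n : ℝ) + 1),
        u 0 r * (backwardTail t a 0 r * smoothTransition (n + 1 - r))) atTop
      (𝓝 (∫ y in Ioi (0 : ℝ), u 0 y * backwardTail t a 0 y)) := by
  have hu := h.integrableOn_initial
  have hΦc : Continuous (backwardTail t a 0) :=
    continuous_iff_continuousAt.2 fun y => (hasDerivAt_backwardTail t a 0 y).continuousAt
  have heq : ∀ n : ℕ, ∫ r in (0 : ℝ)..((n : ℝ) + 1),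
      u 0 r * (backwardTail t a 0 r * smoothTransition (n + 1 - r)) =
      ∫ r in Ioi (0 : ℝ), u 0 r * (backwardTail t a 0 r * smoothTransition (n + 1 - r)) := by
    intro n
    rw [intervalIntegral.integral_of_le (by positivity)]
    refine (setIntegral_eq_of_subset_of_forall_sdiff_eq_zero measurableSet_Ioi
      Ioc_subset_Ioi_self fun r hr => ?_).symm
    have : (n : ℝ) + 1 - r ≤ 0 := by
      by_contra! hlt
      exact hr.2 ⟨hr.1, by linarith⟩
    simp [smoothTransition.zero_of_nonpos this]
  simp_rw [heq]
  refine tendsto_integral_of_dominated_convergence (fun r => ‖u 0 r‖) (fun n => ?_) hu.norm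
    (fun n => ae_of_all _ fun r => ?_) (ae_of_all _ fun r => ?_)
  · exact hu.aestronglyMeasurable.mul (hΦc.mul
      (smoothTransition.continuous.comp (by fun_prop))).aestronglyMeasurable
  · rw [norm_mul]
    refine mul_le_of_le_one_right (norm_nonneg _) ?_
    have h0 := backwardTail_nonneg t a 0 r
    have h1 := smoothTransition.nonneg (n + 1 - r)
    rw [Real.norm_eq_abs, abs_of_nonneg (mul_nonneg h0 h1)]
    exact mul_le_one₀ (backwardTail_le_one _ _ _ _) h1 (smoothTransition.le_one _)
  · refine tendsto_const_nhds.congr' ?_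
    filter_upwards [tendsto_natCast_atTop_atTop.eventually_ge_atTop r] with n hn
    rw [smoothTransition.one_of_one_le (by linarith), mul_one]

theorem integrableOn_heatK_boundary (h : StefanSolution z u) {t : ℝ} (ht : 0 < t) :
    IntegrableOn (fun s => heatK (t - s) (z t - z s)) (Icc 0 t) := by
  rw [integrableOn_Icc_iff_integrableOn_Ioo]
  have hb : IntegrableOn (fun s => (t - s) ^ (-(1 / 2) : ℝ)) (Ioo 0 t) := by
    have := (intervalIntegral.intervalIntegrable_rpow' (a := 0) (b := t)
      (r := (-(1 / 2) : ℝ)) (by norm_num)).comp_sub_left t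
    rw [sub_zero, sub_self] at this
    exact ((intervalIntegrable_iff_integrableOn_Ioc_of_le ht.le).1 this.symm).mono_set
      Ioo_subset_Ioc_self
  have hc : ContinuousOn (fun s => heatK (t - s) (z t - z s)) (Ioo 0 t) := by
    have cz : ContinuousOn z (Ioo 0 t) := h.z_cont.mono fun s hs => hs.1.le
    unfold heatK
    refine ContinuousOn.mul (ContinuousOn.inv₀ (by fun_prop) fun s hs => ?_)
      (Real.continuous_exp.comp_continuousOn (ContinuousOn.div (by fun_prop) (by fun_prop)
        fun s hs => ?_))
    · have : 0 < t - s := sub_pos.2 hs.2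
      positivity
    · have : 0 < t - s := sub_pos.2 hs.2
      positivity
  refine hb.mono' (hc.aestronglyMeasurable measurableSet_Ioo) ?_
  refine (ae_restrict_iff' measurableSet_Ioo).2 (ae_of_all _ fun s hs => ?_)
  have hts : 0 < t - s := sub_pos.2 hs.2
  rw [Real.norm_eq_abs, abs_of_nonneg (heatK_nonneg _ _), heatK_eq_scaled hts,
    Real.rpow_neg hts.le, ← Real.sqrt_eq_rpow, ← one_div]
  gcongr
  exact heatK_one_le_one _

end StefanSolution

/-- The moving boundary of a classical Stefan solution satisfies the integral equation
`∫₀^∞ p(t, z₂(t)-y)(𝒰₂(0,0) - 𝒰₂(0,y)) dy = ∫₀ᵗ p(t-s, z₂(t)-z₂(s)) ds` for all `t > 0`. -/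
theorem stefan_boundary_integral_equation (z₂ : ℝ → ℝ) (u₂ : ℝ → ℝ → ℝ)
    (h : StefanSolution z₂ u₂) (t : ℝ) (ht : 0 < t) :
    (∫ y in Set.Ioi (0:ℝ), heatK t (z₂ t - y) * (tailDist u₂ 0 0 - tailDist u₂ 0 y))
      = ∫ s in (0:ℝ)..t, heatK (t - s) (z₂ t - z₂ s) := by
  obtain ⟨M, hM⟩ := h.u_bdd
  obtain ⟨C, -, hC⟩ := h.abs_truncated_sub_le
    (fun s hs x hx => hM (s, x) (h.mem_closure hs hx)) t
  rw [h.integral_heatK_mul_tailDist ht]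
  have hle : ∀ τ ∈ Ioo 0 t, |(∫ y in Ioi (0 : ℝ), u₂ 0 y * backwardTail t (z₂ t) 0 y) -
      ∫ s in (0 : ℝ)..τ, heatK (t - s) (z₂ t - z₂ s)| ≤ M * ((z₂ t - z₂ τ) + √(t - τ)) := by
    intro τ hτ
    refine le_of_tendsto_of_tendsto ((h.tendsto_truncated t (z₂ t)).sub_const _).abs
      (g := fun n : ℕ => M * ((z₂ t - z₂ τ) + √(t - τ)) +
        M * C * (1 / √(t - τ) + 1) * τ * (rexp (-((n - z₂ t) / √t)) * ((n : ℝ) + 1))) ?_ ?_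
    · simpa using ((tendsto_linear_mul_exp_neg (z₂ t) (Real.sqrt_pos.2 ht)).const_mul
        (M * C * (1 / √(t - τ) + 1) * τ)).const_add (M * ((z₂ t - z₂ τ) + √(t - τ)))
    · filter_upwards [tendsto_natCast_atTop_atTop.eventually_gt_atTop (z₂ t)] with n hn
      refine (hC τ hτ.1 hτ.2 n hn).trans_eq ?_
      ring
  have hne : (𝓝[Ioo 0 t] t).NeBot := by
    rw [nhdsWithin_Ioo_eq_nhdsLT ht]
    infer_instance
  have hJ : Tendsto (fun τ => ∫ s in (0 : ℝ)..τ, heatK (t - s) (z₂ t - z₂ s)) (𝓝[Ioo 0 t] t)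
      (𝓝 (∫ s in (0 : ℝ)..t, heatK (t - s) (z₂ t - z₂ s))) := by
    have hint := h.integrableOn_heatK_boundary ht
    rw [← uIcc_of_le ht.le] at hint
    have hc := intervalIntegral.continuousOn_primitive_interval hint
    rw [uIcc_of_le ht.le] at hc
    exact (hc t ⟨ht.le, le_rfl⟩).tendsto.mono_left (nhdsWithin_mono _ Ioo_subset_Icc_self)
  have hz : Tendsto z₂ (𝓝[Ioo 0 t] t) (𝓝 (z₂ t)) :=
    (h.z_cont t ht.le).mono_left (nhdsWithin_mono _ fun s hs => hs.1.le)
  have hsq : Tendsto (fun τ => √(t - τ)) (𝓝[Ioo 0 t] t) (𝓝 0) := by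
    have hc : Continuous fun τ => √(t - τ) := by fun_prop
    simpa using (hc.tendsto t).mono_left nhdsWithin_le_nhds
  have hrhs : Tendsto (fun τ => M * ((z₂ t - z₂ τ) + √(t - τ))) (𝓝[Ioo 0 t] t) (𝓝 0) := by
    simpa using ((hz.const_sub (z₂ t)).add hsq).const_mul M
  have hfin := le_of_tendsto_of_tendsto (hJ.const_sub _).abs hrhs
    (eventually_nhdsWithin_of_forall hle)
  exact sub_eq_zero.1 (abs_nonpos_iff.1 hfin)
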